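/- Let T = (V, E) be a finite tree, let (c_e)_{e ∈ E} ⊂ [0,1], and set ĉ = max_{e ∈ E} c_e. If ĉ < 1/2, then ∫_{[0,1]^V} ∏_{e = {u,v} ∈ E} 𝟙{|x_u − x_v| ≤ c_e} d𝐱 ≥ (1 − 2ĉ)^{|E|} · ∏_{e ∈ E} 2c_e. -/

import Mathlib

open MeasureTheory

/-- The gap `|x_u − x_v|` across an undirected edge `{u,v}`. -/
noncomputable def edgeGap {V : Type*} (x : V → ℝ) : Sym2 V → ℝ :=
  Sym2.lift ⟨fun u v => |x u - x v|, fun u v => abs_sub_comm (x u) (x v)⟩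

open scoped ENNReal

/-- Chebyshev's integral inequality: monovarying functions are positively correlated. -/
theorem Monovary.lintegral_mul_lintegral_le {α : Type*} [MeasurableSpace α] {μ : Measure α}
    [IsProbabilityMeasure μ] {f g : α → ℝ≥0∞} (h : Monovary f g)
    (hf : Measurable f) (hg : Measurable g) :
    (∫⁻ x, f x ∂μ) * ∫⁻ x, g x ∂μ ≤ ∫⁻ x, f x * g x ∂μ := by
  have rearrange : ∀ {x y}, f x ≤ f y → g x ≤ g y →
      f x * g y + f y * g x ≤ f x * g x + f y * g y := by
    intro x y hfxy hgxy
    obtain ⟨d, hd⟩ := exists_add_of_le hgxy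
    rw [hd, mul_add, mul_add, add_right_comm, add_assoc (f x * g x)]
    gcongr
  have pointwise : ∀ x y, f x * g y + f y * g x ≤ f x * g x + f y * g y := by
    intro x y
    rcases lt_trichotomy (g x) (g y) with hxy | hxy | hxy
    · exact rearrange (h hxy) hxy.le
    · rw [hxy]
    · rw [add_comm, add_comm (f x * g x)]
      exact rearrange (h hxy) hxy.le
  have double : ∫⁻ x, ∫⁻ y, f x * g y + f y * g x ∂μ ∂μ
      ≤ ∫⁻ x, ∫⁻ y, f x * g x + f y * g y ∂μ ∂μ :=
    lintegral_mono fun x => lintegral_mono fun y => pointwise x y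
  have hfg : Measurable fun x => f x * g x := hf.mul hg
  have left : ∀ x, ∫⁻ y, f x * g y + f y * g x ∂μ
      = f x * (∫⁻ y, g y ∂μ) + (∫⁻ y, f y ∂μ) * g x := fun x => by
    rw [lintegral_add_left (by fun_prop), lintegral_const_mul _ hg, lintegral_mul_const _ hf]
  have right : ∀ x, ∫⁻ y, f x * g x + f y * g y ∂μ
      = f x * g x + ∫⁻ y, f y * g y ∂μ := fun x => by
    rw [lintegral_add_left (by fun_prop), lintegral_const, measure_univ, mul_one]
  simp_rw [left, right] at double
  rw [lintegral_add_left (by fun_prop), lintegral_mul_const _ hf, lintegral_const_mul _ hg,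
    lintegral_add_left hfg, lintegral_const, measure_univ, mul_one, ← two_mul, ← two_mul] at double
  exact (ENNReal.mul_le_mul_iff_right (by simp) (by simp)).1 double

/-- A nontrivial finite forest has a vertex with exactly one neighbour. -/
theorem SimpleGraph.IsAcyclic.exists_adj_forall_adj_eq {V : Type*} [Finite V]
    {G : SimpleGraph V} (hG : G.IsAcyclic) (hne : G ≠ ⊥) :
    ∃ l u, G.Adj l u ∧ ∀ w, G.Adj l w → w = u := by
  classical
  have := Fintype.ofFinite V
  obtain ⟨a, b, hab⟩ := SimpleGraph.ne_bot_iff_exists_adj.1 hne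
  let C := G.connectedComponentMk a
  have hb : b ∈ C := SimpleGraph.ConnectedComponent.sound hab.reachable.symm
  have : Nontrivial C := ⟨⟨a, rfl⟩, ⟨b, hb⟩, fun h => hab.ne (congrArg Subtype.val h)⟩
  obtain ⟨l, hl⟩ := (hG.isTree_connectedComponent C).exists_vert_degree_one_of_nontrivial
  obtain ⟨u, hu, huniq⟩ := SimpleGraph.degree_eq_one_iff_existsUnique_adj.1 hl
  refine ⟨l, u, hu, fun w hw => ?_⟩
  have hwC : w ∈ C :=
    (SimpleGraph.ConnectedComponent.sound hw.reachable.symm : G.connectedComponentMk w = _).trans l.2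
  exact congrArg Subtype.val (huniq ⟨w, hwC⟩ hw)

/-- Lebesgue measure on the unit interval, as a measure on `ℝ`. -/
noncomputable abbrev unitMeasure : Measure ℝ := volume.restrict (Set.Icc 0 1)

instance : IsProbabilityMeasure unitMeasure := ⟨by simp⟩

/-- `F` is symmetric about `1/2` and decreases away from it. -/
def CenteredUnimodal (F : ℝ → ℝ≥0∞) : Prop :=
  ∀ ⦃x y : ℝ⦄, |x - 1 / 2| ≤ |y - 1 / 2| → F y ≤ F x

namespace CenteredUnimodal

variable {F H : ℝ → ℝ≥0∞}

theorem const (a : ℝ≥0∞) : CenteredUnimodal fun _ => a := fun _ _ _ => le_rfl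

theorem mul (hF : CenteredUnimodal F) (hH : CenteredUnimodal H) :
    CenteredUnimodal fun x => F x * H x :=
  fun _ _ h => mul_le_mul' (hF h) (hH h)

theorem monovary (hF : CenteredUnimodal F) (hH : CenteredUnimodal H) : Monovary F H := by
  intro x y hxy
  rcases le_total |y - 1 / 2| |x - 1 / 2| with h | h
  · exact hF h
  · exact absurd (hH h) hxy.not_ge

theorem measurable (hF : CenteredUnimodal F) : Measurable F := by
  have profile : Antitone fun r : ℝ => F (1 / 2 + max r 0) := fun r s hrs => hF <| by
    simpa using abs_le_abs_of_nonneg (le_max_right r 0) (max_le_max_right 0 hrs)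
  have factor : F = (fun r : ℝ => F (1 / 2 + max r 0)) ∘ fun x => |x - 1 / 2| := by
    funext x
    apply le_antisymm <;> apply hF <;> simp
  rw [factor]
  exact profile.measurable.comp (by fun_prop)

theorem indicator_Icc (hF : CenteredUnimodal F) :
    CenteredUnimodal ((Set.Icc (0 : ℝ) 1).indicator F) := by
  intro x y h
  by_cases hy : y ∈ Set.Icc (0 : ℝ) 1
  · have hx : x ∈ Set.Icc (0 : ℝ) 1 := by
      have : |y - 1 / 2| ≤ 1 / 2 := abs_le.2 ⟨by linarith [hy.1], by linarith [hy.2]⟩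
      have := abs_le.1 (h.trans this)
      exact ⟨by linarith, by linarith⟩
    rw [Set.indicator_of_mem hy, Set.indicator_of_mem hx]
    exact hF h
  · rw [Set.indicator_of_notMem hy]
    exact zero_le

end CenteredUnimodal

/-- The integral of `F` over the points of the unit interval within distance `c` of `x`. -/
noncomputable def bandIntegral (c : ℝ) (F : ℝ → ℝ≥0∞) (x : ℝ) : ℝ≥0∞ :=
  ∫⁻ t, (if |t - x| ≤ c then 1 else 0) * F t ∂unitMeasure

theorem measurable_band_indicator (c : ℝ) :
    Measurable fun p : ℝ × ℝ => if |p.1 - p.2| ≤ c then (1 : ℝ≥0∞) else 0 :=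
  Measurable.ite (measurableSet_le (by fun_prop) measurable_const) measurable_const
    measurable_const

/-- Reflecting in the midpoint of `x` and `y` exchanges the two bands and moves the points that
lie only in the band of `y` closer to `1/2`. -/
theorem CenteredUnimodal.bandIntegral {F : ℝ → ℝ≥0∞} (hF : CenteredUnimodal F) (c : ℝ) :
    CenteredUnimodal (bandIntegral c F) := by
  intro x y hxy
  set E := (Set.Icc (0 : ℝ) 1).indicator F with hE
  have hEu : CenteredUnimodal E := hF.indicator_Icc
  have expand : ∀ z, _root_.bandIntegral c F z
      = ∫⁻ t, (if |t - z| ≤ c then 1 else 0) * E t := by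
    intro z
    rw [_root_.bandIntegral, ← lintegral_indicator measurableSet_Icc]
    refine lintegral_congr fun t => ?_
    by_cases ht : t ∈ Set.Icc (0 : ℝ) 1 <;> simp only [hE, Set.indicator_of_mem,
      Set.indicator_of_notMem, ht, not_false_eq_true, mul_zero]
  have hmeas : ∀ z, Measurable fun t => (if |t - z| ≤ c then (1 : ℝ≥0∞) else 0) * E t :=
    fun z => ((measurable_band_indicator c).comp (by fun_prop : Measurable fun t => (t, z))).mul
      hEu.measurable
  have reflect : ∀ z, 2 * ∫⁻ t, (if |t - z| ≤ c then 1 else 0) * E t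
      = ∫⁻ t, ((if |t - z| ≤ c then 1 else 0) * E t
          + (if |(x + y - t) - z| ≤ c then 1 else 0) * E (x + y - t)) := by
    intro z
    rw [lintegral_add_left (hmeas z),
      lintegral_sub_left_eq_self (fun t => (if |t - z| ≤ c then (1 : ℝ≥0∞) else 0) * E t), two_mul]
  have closer : ∀ {x y t : ℝ}, |x - 1 / 2| ≤ |y - 1 / 2| → |t - y| ≤ c → ¬ |t - x| ≤ c →
      |(x + y - t) - 1 / 2| ≤ |t - 1 / 2| := by
    intro x y t hxy hy hx
    have hlt := sq_lt_sq.2 (hy.trans_lt (not_le.1 hx))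
    have hle := sq_le_sq.2 hxy
    refine sq_le_sq.1 ?_
    have hband : 0 < (y - x) * (2 * t - x - y) := by linarith
    have hcenter : 0 ≤ (y - x) * (x + y - 1) := by linarith
    have : 0 ≤ (2 * t - x - y) * (x + y - 1) := by
      rcases mul_pos_iff.1 hband with ⟨h, ht⟩ | ⟨h, ht⟩
      · exact mul_nonneg ht.le (nonneg_of_mul_nonneg_right hcenter h)
      · exact mul_nonneg_of_nonpos_of_nonpos ht.le (nonpos_of_mul_nonneg_right hcenter h)
    linarith
  have key : 2 * ∫⁻ t, (if |t - y| ≤ c then 1 else 0) * E t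
      ≤ 2 * ∫⁻ t, (if |t - x| ≤ c then 1 else 0) * E t := by
    rw [reflect, reflect]
    refine lintegral_mono fun t => ?_
    have hy : |(x + y - t) - y| = |t - x| := by rw [abs_sub_comm]; ring_nf
    have hx : |(x + y - t) - x| = |t - y| := by rw [abs_sub_comm]; ring_nf
    rw [hx, hy]
    by_cases hty : |t - y| ≤ c <;> by_cases htx : |t - x| ≤ c
    · simp [hty, htx]
    · simpa [hty, htx] using hEu (closer hxy hty htx)
    · have := closer (t := x + y - t) hxy (by rwa [hy]) (by rwa [hx])
      simpa [hty, htx] using hEu (by simpa using this)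
    · simp [hty, htx]
  rw [expand, expand]
  exact (ENNReal.mul_le_mul_iff_right (by simp) (by simp)).1 key

/-- The measure of the band `|x - t| ≤ c` in the unit square is at least `2c(1 - 2c)`. -/
theorem le_lintegral_bandIntegral_one {c : ℝ} (hc : 0 ≤ c) :
    ENNReal.ofReal ((1 - 2 * c) * (2 * c)) ≤ ∫⁻ x, bandIntegral c (fun _ => 1) x ∂unitMeasure := by
  have inner : ∀ x ∈ Set.Icc c (1 - c), bandIntegral c (fun _ => 1) x = ENNReal.ofReal (2 * c) := by
    intro x hx
    have hband : ∀ t, (if |t - x| ≤ c then (1 : ℝ≥0∞) else 0) * 1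
        = (Set.Icc (x - c) (x + c)).indicator 1 t := by
      intro t
      have : |t - x| ≤ c ↔ t ∈ Set.Icc (x - c) (x + c) := by
        rw [abs_le, Set.mem_Icc]
        constructor <;> rintro ⟨h₁, h₂⟩ <;> constructor <;> linarith
      simp [Set.indicator_apply, this]
    have hsub : Set.Icc (x - c) (x + c) ⊆ Set.Icc 0 1 :=
      Set.Icc_subset_Icc (by linarith [hx.1]) (by linarith [hx.2])
    simp_rw [bandIntegral, hband]
    rw [lintegral_indicator_one measurableSet_Icc, Measure.restrict_apply measurableSet_Icc,
      Set.inter_eq_left.2 hsub, Real.volume_Icc]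
    ring_nf
  calc ENNReal.ofReal ((1 - 2 * c) * (2 * c))
      = ∫⁻ x in Set.Icc c (1 - c), ENNReal.ofReal (2 * c) := by
        rw [setLIntegral_const, Real.volume_Icc, ← ENNReal.ofReal_mul (by linarith)]
        ring_nf
    _ = ∫⁻ x in Set.Icc c (1 - c), bandIntegral c (fun _ => 1) x :=
        setLIntegral_congr_fun measurableSet_Icc fun x hx => (inner x hx).symm
    _ ≤ _ := lintegral_mono_set (Set.Icc_subset_Icc hc (by linarith))

theorem CenteredUnimodal.le_lintegral_bandIntegral {F : ℝ → ℝ≥0∞} (hF : CenteredUnimodal F)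
    {c : ℝ} (hc : 0 ≤ c) :
    ENNReal.ofReal ((1 - 2 * c) * (2 * c)) * ∫⁻ x, F x ∂unitMeasure
      ≤ ∫⁻ x, _root_.bandIntegral c F x ∂unitMeasure := by
  have hone := (CenteredUnimodal.const 1).bandIntegral c
  have swap : ∫⁻ x, _root_.bandIntegral c F x ∂unitMeasure
      = ∫⁻ t, _root_.bandIntegral c (fun _ => 1) t * F t ∂unitMeasure := by
    simp_rw [_root_.bandIntegral]
    rw [lintegral_lintegral_swap]
    · refine lintegral_congr fun t => ?_
      have hmeas : Measurable fun x => if |t - x| ≤ c then (1 : ℝ≥0∞) else 0 :=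
        (measurable_band_indicator c).comp (by fun_prop : Measurable fun x => (t, x))
      rw [lintegral_mul_const _ hmeas]
      simp_rw [mul_one, abs_sub_comm t]
    · exact (((measurable_band_indicator c).comp measurable_swap).mul
        (hF.measurable.comp measurable_snd)).aemeasurable
  rw [swap]
  exact (mul_le_mul_left (le_lintegral_bandIntegral_one hc) _).trans
    ((hone.monovary hF).lintegral_mul_lintegral_le hone.measurable hF.measurable)

theorem measurable_edgeGap_indicator {V : Type*} [Countable V] (c : ℝ) (e : Sym2 V) :
    Measurable fun x : V → ℝ => if edgeGap x e ≤ c then (1 : ℝ≥0∞) else 0 := by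
  induction e using Sym2.ind with
  | _ u v =>
    exact (measurable_band_indicator c).comp
      (by fun_prop : Measurable fun x : V → ℝ => (x u, x v))

theorem edgeGap_update_of_notMem {V : Type*} [DecidableEq V] (x : V → ℝ) {l : V} {e : Sym2 V}
    (h : l ∉ e) (t : ℝ) : edgeGap (Function.update x l t) e = edgeGap x e := by
  induction e using Sym2.ind with
  | _ u v =>
    rw [Sym2.mem_iff, not_or] at h
    simp [edgeGap, Function.update_of_ne (Ne.symm h.1), Function.update_of_ne (Ne.symm h.2)]

/-- Independent coordinates: the integral of a product is the product of the integrals. -/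
theorem lintegral_pi_prod {V : Type*} [Fintype V] {X : V → Type*} [∀ v, MeasurableSpace (X v)]
    (μ : ∀ v, Measure (X v)) [∀ v, IsProbabilityMeasure (μ v)] {F : ∀ v, X v → ℝ≥0∞}
    (hF : ∀ v, Measurable (F v)) :
    ∫⁻ x, ∏ v, F v (x v) ∂Measure.pi μ = ∏ v, ∫⁻ t, F v t ∂μ v := by
  rw [ProbabilityTheory.lintegral_prod_eq_prod_lintegral_of_indepFun Finset.univ
    (fun v (x : ∀ v, X v) => F v (x v))
    (ProbabilityTheory.iIndepFun_pi fun v => (hF v).aemeasurable)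
    fun v => (hF v).comp (measurable_pi_apply v)]
  exact Finset.prod_congr rfl fun v _ => (measurePreserving_eval μ v).lintegral_comp (hF v)

theorem prod_ite_eq_one_eq_prod_erase {V M : Type*} [Fintype V] [DecidableEq V] [CommMonoid M]
    (l : V) (a : V → M) :
    ∏ v, (if v = l then 1 else a v) = ∏ v ∈ Finset.univ.erase l, a v := by
  rw [← Finset.mul_prod_erase _ _ (Finset.mem_univ l), if_pos rfl, one_mul]
  exact Finset.prod_congr rfl fun v hv => if_neg (Finset.ne_of_mem_erase hv)

/-- The band integral over a forest, with a unimodal weight at each vertex. Integrating out a leaf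
`l` with neighbour `u` multiplies the weight at `u` by the band integral of the weight at `l`. -/
theorem forest_weighted_band_lintegral {V : Type*} [Fintype V] [DecidableEq V] (c : Sym2 V → ℝ)
    (E : Finset (Sym2 V)) (G : SimpleGraph V) (hGE : G.edgeSet = E) (hG : G.IsAcyclic)
    (hc : ∀ e ∈ E, 0 ≤ c e) (F : V → ℝ → ℝ≥0∞) (hF : ∀ v, CenteredUnimodal (F v)) :
    (∏ e ∈ E, ENNReal.ofReal ((1 - 2 * c e) * (2 * c e))) * ∏ v, ∫⁻ t, F v t ∂unitMeasure
      ≤ ∫⁻ x, (∏ v, F v (x v)) * ∏ e ∈ E, (if edgeGap x e ≤ c e then 1 else 0)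
          ∂Measure.pi fun _ => unitMeasure := by
  induction E using Finset.strongInduction generalizing G F with
  | H E ih =>
  rcases E.eq_empty_or_nonempty with rfl | ⟨e₀, he₀⟩
  · simp [lintegral_pi_prod (fun _ => unitMeasure) fun v => (hF v).measurable]
  have hbot : G ≠ ⊥ := by
    rintro rfl
    rw [SimpleGraph.edgeSet_bot] at hGE
    exact (hGE ▸ Finset.mem_coe.2 he₀ : e₀ ∈ (∅ : Set (Sym2 V)))
  obtain ⟨l, u, hlu, huniq⟩ := hG.exists_adj_forall_adj_eq hbot
  have he : s(l, u) ∈ E := Finset.mem_coe.1 (hGE ▸ hlu)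
  have hleaf : ∀ e ∈ E.erase s(l, u), l ∉ e := by
    rintro e heE ⟨w, rfl⟩
    have hlw : G.Adj l w := by
      rw [← SimpleGraph.mem_edgeSet, hGE]
      exact Finset.mem_of_mem_erase heE
    exact Finset.ne_of_mem_erase heE (by rw [huniq w hlw])
  set K := bandIntegral (c s(l, u)) (F l) with hK
  have hKu : CenteredUnimodal K := (hF l).bandIntegral _
  let A : V → ℝ → ℝ≥0∞ := fun v t => if v = l then 1 else F v t
  let B : V → ℝ → ℝ≥0∞ := fun v t => if v = u then K t else 1
  have hA : ∀ v, CenteredUnimodal (A v) := fun v => by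
    by_cases h : v = l
    · simpa [A, h] using CenteredUnimodal.const 1
    · simpa [A, h] using hF v
  have hB : ∀ v, CenteredUnimodal (B v) := fun v => by
    by_cases h : v = u
    · simpa [B, h] using hKu
    · simpa [B, h] using CenteredUnimodal.const 1
  have hAB : ∀ v, CenteredUnimodal fun t => A v t * B v t := fun v => (hA v).mul (hB v)
  have integrate_leaf :
      ∫⁻ x, (∏ v, F v (x v)) * ∏ e ∈ E, (if edgeGap x e ≤ c e then 1 else 0)
          ∂Measure.pi (fun _ => unitMeasure)
        = ∫⁻ x, (∏ v, A v (x v) * B v (x v))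
            * ∏ e ∈ E.erase s(l, u), (if edgeGap x e ≤ c e then 1 else 0)
          ∂Measure.pi (fun _ => unitMeasure) := by
    have measurable_weighted : ∀ (H : V → ℝ → ℝ≥0∞) (S : Finset (Sym2 V)),
        (∀ v, CenteredUnimodal (H v)) → Measurable fun x : V → ℝ =>
          (∏ v, H v (x v)) * ∏ e ∈ S, (if edgeGap x e ≤ c e then (1 : ℝ≥0∞) else 0) :=
      fun H S hH => (Finset.measurable_prod _ fun v _ =>
        (hH v).measurable.comp (measurable_pi_apply v)).mul
        (Finset.measurable_prod _ fun e _ => measurable_edgeGap_indicator _ e)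
    refine lintegral_eq_of_lmarginal_eq {l} (measurable_weighted F E hF)
      (measurable_weighted (fun v t => A v t * B v t) _ hAB) ?_
    rw [lmarginal_singleton, lmarginal_singleton]
    funext x
    set P := ∏ v ∈ Finset.univ.erase l, F v (x v)
    set Q := ∏ e ∈ E.erase s(l, u), (if edgeGap x e ≤ c e then (1 : ℝ≥0∞) else 0)
    have hP : ∀ t, ∏ v ∈ Finset.univ.erase l, F v (Function.update x l t v) = P := fun t =>
      Finset.prod_congr rfl fun v hv => by
        rw [Function.update_of_ne (Finset.ne_of_mem_erase hv)]
    have hQ : ∀ t, ∏ e ∈ E.erase s(l, u),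
        (if edgeGap (Function.update x l t) e ≤ c e then (1 : ℝ≥0∞) else 0) = Q := fun t =>
      Finset.prod_congr rfl fun e he => by rw [edgeGap_update_of_notMem x (hleaf e he)]
    have hgap : ∀ t, edgeGap (Function.update x l t) s(l, u) = |t - x u| := fun t => by
      simp [edgeGap, Function.update_of_ne hlu.ne']
    have before : ∀ t, (∏ v, F v (Function.update x l t v))
          * ∏ e ∈ E, (if edgeGap (Function.update x l t) e ≤ c e then (1 : ℝ≥0∞) else 0)
        = P * Q * ((if |t - x u| ≤ c s(l, u) then 1 else 0) * F l t) := fun t => by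
      rw [← Finset.mul_prod_erase _ _ (Finset.mem_univ l), ← Finset.mul_prod_erase E _ he, hP, hQ,
        hgap, Function.update_self]
      ring
    have after : ∀ t, (∏ v, A v (Function.update x l t v) * B v (Function.update x l t v))
          * ∏ e ∈ E.erase s(l, u),
            (if edgeGap (Function.update x l t) e ≤ c e then (1 : ℝ≥0∞) else 0)
        = P * Q * K (x u) := fun t => by
      rw [Finset.prod_mul_distrib, prod_ite_eq_one_eq_prod_erase, hP, hQ, Finset.prod_ite_eq',
        if_pos (Finset.mem_univ u), Function.update_of_ne hlu.ne']
      ring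
    have hmeas : Measurable fun t => (if |t - x u| ≤ c s(l, u) then (1 : ℝ≥0∞) else 0) * F l t :=
      ((measurable_band_indicator _).comp (by fun_prop : Measurable fun t => (t, x u))).mul
        (hF l).measurable
    simp_rw [before, after]
    rw [lintegral_const_mul _ hmeas, lintegral_const, measure_univ, mul_one, hK, bandIntegral]
  have weights : ENNReal.ofReal ((1 - 2 * c s(l, u)) * (2 * c s(l, u)))
      * ∏ v, ∫⁻ t, F v t ∂unitMeasure ≤ ∏ v, ∫⁻ t, A v t * B v t ∂unitMeasure := by
    have hAint : ∀ v, ∫⁻ t, A v t ∂unitMeasure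
        = if v = l then 1 else ∫⁻ t, F v t ∂unitMeasure := fun v => by
      by_cases h : v = l <;> simp [A, h]
    have hBint : ∀ v, ∫⁻ t, B v t ∂unitMeasure
        = if v = u then ∫⁻ t, K t ∂unitMeasure else 1 := fun v => by
      by_cases h : v = u <;> simp [B, h]
    calc ENNReal.ofReal ((1 - 2 * c s(l, u)) * (2 * c s(l, u))) * ∏ v, ∫⁻ t, F v t ∂unitMeasure
        = (ENNReal.ofReal ((1 - 2 * c s(l, u)) * (2 * c s(l, u))) * ∫⁻ t, F l t ∂unitMeasure)
            * ∏ v ∈ Finset.univ.erase l, ∫⁻ t, F v t ∂unitMeasure := by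
          rw [mul_assoc, Finset.mul_prod_erase _ (fun v => ∫⁻ t, F v t ∂unitMeasure)
            (Finset.mem_univ l)]
      _ ≤ (∫⁻ t, K t ∂unitMeasure) * ∏ v ∈ Finset.univ.erase l, ∫⁻ t, F v t ∂unitMeasure := by
          gcongr
          exact (hF l).le_lintegral_bandIntegral (hc _ he)
      _ = ∏ v, (∫⁻ t, A v t ∂unitMeasure) * ∫⁻ t, B v t ∂unitMeasure := by
          simp_rw [hAint, hBint]
          rw [Finset.prod_mul_distrib, prod_ite_eq_one_eq_prod_erase, Finset.prod_ite_eq',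
            if_pos (Finset.mem_univ u), mul_comm]
      _ ≤ _ := Finset.prod_le_prod' fun v _ => ((hA v).monovary (hB v)).lintegral_mul_lintegral_le
          (hA v).measurable (hB v).measurable
  have hdelete : (G.deleteEdges {s(l, u)}).edgeSet = (E.erase s(l, u) : Finset (Sym2 V)) := by
    rw [SimpleGraph.edgeSet_deleteEdges, hGE, Finset.coe_erase]
  rw [integrate_leaf, ← Finset.mul_prod_erase E _ he, mul_right_comm, mul_comm]
  exact (mul_le_mul_right weights _).trans <|
    ih _ (Finset.erase_ssubset he) _ hdelete (hG.anti (G.deleteEdges_le _))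
      (fun e he => hc e (Finset.mem_of_mem_erase he)) _ hAB

/-- Lower bound on the band-constraint integral over a tree for small band widths:
with `ĉ = max_e c_e < 1/2`, `Int_T(c) ≥ (1 − 2ĉ)^{|E|} ∏_e 2c_e`. -/
theorem tree_band_integral_small_band {V : Type} [Fintype V] [DecidableEq V]
    (G : SimpleGraph V) [Fintype G.edgeSet] (hT : G.IsTree)
    (c : Sym2 V → ℝ) (hc : ∀ e ∈ G.edgeFinset, c e ∈ Set.Icc (0:ℝ) 1)
    (hne : G.edgeFinset.Nonempty)
    (hhat : G.edgeFinset.sup' hne c < 1/2) :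
    (1 - 2 * G.edgeFinset.sup' hne c)^(G.edgeFinset.card) * ∏ e ∈ G.edgeFinset, (2 * c e)
      ≤ ∫ x in Set.univ.pi (fun _ : V => Set.Icc (0:ℝ) 1),
          ∏ e ∈ G.edgeFinset, (if edgeGap x e ≤ c e then (1:ℝ) else 0) := by
  have hle : ∀ e ∈ G.edgeFinset, c e ≤ G.edgeFinset.sup' hne c := fun e he => Finset.le_sup' c he
  have hforest := forest_weighted_band_lintegral c G.edgeFinset G (by simp) hT.isAcyclic
    (fun e he => (hc e he).1) (fun _ _ => 1) fun _ => CenteredUnimodal.const 1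
  have hcube : (volume : Measure (V → ℝ)).restrict (Set.univ.pi fun _ => Set.Icc (0 : ℝ) 1)
      = Measure.pi fun _ => unitMeasure := by
    rw [volume_pi, Measure.restrict_pi_pi]
  have hofReal : ∀ x : V → ℝ,
      ENNReal.ofReal (∏ e ∈ G.edgeFinset, (if edgeGap x e ≤ c e then (1 : ℝ) else 0))
        = ∏ e ∈ G.edgeFinset, (if edgeGap x e ≤ c e then (1 : ℝ≥0∞) else 0) := fun x => by
    rw [ENNReal.ofReal_prod_of_nonneg fun e _ => by split_ifs <;> simp]
    exact Finset.prod_congr rfl fun e _ => by split_ifs <;> simp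
  have hmeas : Measurable fun x : V → ℝ =>
      ∏ e ∈ G.edgeFinset, (if edgeGap x e ≤ c e then (1 : ℝ) else 0) :=
    Finset.measurable_prod _ fun e _ => by
      convert (measurable_edgeGap_indicator (c e) e).ennreal_toReal using 2
      split_ifs <;> simp
  simp only [Finset.prod_const_one, one_mul, lintegral_one, measure_univ, mul_one] at hforest
  rw [← ENNReal.ofReal_prod_of_nonneg fun e he =>
    mul_nonneg (by linarith [hle e he]) (by linarith [(hc e he).1])] at hforest
  rw [hcube, integral_eq_lintegral_of_nonneg_ae
    (ae_of_all _ fun x => Finset.prod_nonneg fun e _ => by split_ifs <;> simp)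
    hmeas.aestronglyMeasurable]
  simp_rw [hofReal]
  have hfinite : ∫⁻ x : V → ℝ, ∏ e ∈ G.edgeFinset, (if edgeGap x e ≤ c e then (1 : ℝ≥0∞) else 0)
      ∂Measure.pi (fun _ => unitMeasure) ≠ ∞ := by
    refine ne_top_of_le_ne_top ENNReal.one_ne_top
      ((lintegral_mono fun x => Finset.prod_le_one' fun e _ => ?_).trans_eq
        (by rw [lintegral_one, measure_univ]))
    split_ifs <;> simp
  refine le_trans ?_ ((ENNReal.ofReal_le_iff_le_toReal hfinite).1 hforest)
  rw [← Finset.prod_const, ← Finset.prod_mul_distrib]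
  refine Finset.prod_le_prod (fun e he => ?_) fun e he => ?_
  · exact mul_nonneg (by linarith) (by linarith [(hc e he).1])
  · exact mul_le_mul_of_nonneg_right (by linarith [hle e he]) (by linarith [(hc e he).1])
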